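/- Let λ > 0 and ν > 0 be real with λ ≠ ν, and let a, b be real. Then ∫_{−∞}^{∞} (e^(−λ·|v−a|)/(2λ)) · (e^(−ν·|v−b|)/(2ν)) dv = (1/(λ²−ν²)) · ( e^(−ν·|b−a|)/(2ν) − e^(−λ·|b−a|)/(2λ) ). -/

import Mathlib

open MeasureTheory Real

/-- The convolution of two exponential kernels, for ordered centres. -/
lemma integral_exp_neg_mul_abs_sub_mul_of_le {l n a b : ℝ} (hl : 0 < l) (hn : 0 < n)
    (hne : l ≠ n) (hab : a ≤ b) :
    ∫ v : ℝ, exp (-l * |v - a|) * exp (-n * |v - b|) =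
      (2 * l * exp (-n * (b - a)) - 2 * n * exp (-l * (b - a))) / (l ^ 2 - n ^ 2) := by
  set f : ℝ → ℝ := fun v => exp (-l * |v - a|) * exp (-n * |v - b|) with hf
  have hcont : Continuous f := by fun_prop
  have hsum : 0 < l + n := by positivity
  have hsub : l - n ≠ 0 := sub_ne_zero.mpr hne
  have hsub' : n - l ≠ 0 := sub_ne_zero.mpr hne.symm
  have left_eq : Set.EqOn f (fun v => exp (-l * a - n * b) * exp ((l + n) * v)) (Set.Iic a) := by
    intro v hv
    have hva : v ≤ a := hv
    simp only [hf]
    rw [abs_of_nonpos (by linarith), abs_of_nonpos (by linarith), ← exp_add, ← exp_add]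
    ring_nf
  have mid_eq : Set.EqOn f (fun v => exp (l * a - n * b) * exp ((n - l) * v)) (Set.uIcc a b) := by
    intro v hv
    rw [Set.uIcc_of_le hab] at hv
    simp only [hf]
    rw [abs_of_nonneg (by linarith [hv.1]), abs_of_nonpos (by linarith [hv.2]), ← exp_add,
      ← exp_add]
    ring_nf
  have right_eq : Set.EqOn f (fun v => exp (l * a + n * b) * exp (-(l + n) * v)) (Set.Ioi b) := by
    intro v hv
    have hbv : b < v := hv
    simp only [hf]
    rw [abs_of_nonneg (by linarith), abs_of_nonneg (by linarith), ← exp_add, ← exp_add]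
    ring_nf
  have left_int : IntegrableOn f (Set.Iic a) :=
    IntegrableOn.congr_fun ((integrableOn_exp_mul_Iic hsum a).const_mul _) left_eq.symm
      measurableSet_Iic
  have right_int : IntegrableOn f (Set.Ioi b) :=
    IntegrableOn.congr_fun ((integrableOn_exp_mul_Ioi (neg_lt_zero.mpr hsum) b).const_mul _)
      right_eq.symm measurableSet_Ioi
  have left_val : ∫ v in Set.Iic a, f v = exp (-n * (b - a)) / (l + n) := by
    rw [setIntegral_congr_fun measurableSet_Iic left_eq, integral_const_mul,
      integral_exp_mul_Iic hsum, ← mul_div_assoc, ← exp_add]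
    ring_nf
  have right_val : ∫ v in Set.Ioi b, f v = exp (-l * (b - a)) / (l + n) := by
    rw [setIntegral_congr_fun measurableSet_Ioi right_eq, integral_const_mul,
      integral_exp_mul_Ioi (neg_lt_zero.mpr hsum), neg_div_neg_eq, ← mul_div_assoc, ← exp_add]
    ring_nf
  have mid_val : ∫ v in a..b, f v = (exp (-l * (b - a)) - exp (-n * (b - a))) / (n - l) := by
    rw [intervalIntegral.integral_congr mid_eq, intervalIntegral.integral_const_mul,
      intervalIntegral.integral_comp_mul_left _ hsub', integral_exp, smul_eq_mul,
      show -l * (b - a) = (l * a - n * b) + (n - l) * b by ring,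
      show -n * (b - a) = (l * a - n * b) + (n - l) * a by ring, exp_add, exp_add]
    ring
  have mid_int : IntegrableOn f (Set.Ioc a b) :=
    (hcont.integrableOn_Icc).mono_set Set.Ioc_subset_Icc_self
  have Iic_int : IntegrableOn f (Set.Iic b) := by
    rw [← Set.Iic_union_Ioc_eq_Iic hab]
    exact left_int.union mid_int
  have Iic_val := intervalIntegral.integral_Iic_sub_Iic left_int Iic_int
  rw [← intervalIntegral.integral_Iic_add_Ioi Iic_int right_int, sub_eq_iff_eq_add.mp Iic_val,
    left_val, mid_val, right_val, show l ^ 2 - n ^ 2 = (l + n) * (l - n) by ring,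
    ← neg_sub l n]
  field_simp
  ring

/-- Convolution of two one-dimensional exponential Green kernels (the `d = 1` AdS bubble
with fixed end-points). -/
theorem bubble_dim_one (lam nu a b : ℝ) (hlam : 0 < lam) (hnu : 0 < nu) (hne : lam ≠ nu) :
    ∫ v : ℝ, Real.exp (-lam * |v - a|) / (2 * lam) * (Real.exp (-nu * |v - b|) / (2 * nu)) =
      1 / (lam ^ 2 - nu ^ 2) *
        (Real.exp (-nu * |b - a|) / (2 * nu) - Real.exp (-lam * |b - a|) / (2 * lam)) := by
  have hsq : lam ^ 2 - nu ^ 2 ≠ 0 := by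
    rw [sq_sub_sq]
    exact mul_ne_zero (by positivity) (sub_ne_zero.mpr hne)
  simp_rw [div_mul_div_comm, integral_div]
  rcases le_total a b with hab | hba
  · rw [integral_exp_neg_mul_abs_sub_mul_of_le hlam hnu hne hab,
      abs_of_nonneg (sub_nonneg.mpr hab)]
    field_simp
  · simp_rw [mul_comm (exp (-lam * _))]
    rw [integral_exp_neg_mul_abs_sub_mul_of_le hnu hlam hne.symm hba,
      abs_of_nonpos (sub_nonpos.mpr hba), neg_sub, ← neg_sub (lam ^ 2)]
    field_simp
    ring
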